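/- (Theorem 2) Suppose 0 < d₁ < d₂ and w / d₁ < √3 − 1 (so also w / d₂ < √3 − 1). If σ₁ maximizes σ ↦ V(σ, d₁) over (0, ∞) and σ₂ maximizes σ ↦ V(σ, d₂) over (0, ∞), then σ₁ < σ₂; combined with the strict decrease of the optimal value in d, this shows that the optimal variance strictly increases when the optimal value V(σ*, d) decreases. -/

import Mathlib

open Real MeasureTheory

/-- Gaussian density with mean 0 and standard deviation `σ`. -/
noncomputable def gauss (σ x : ℝ) : ℝ :=
  (1 / (σ * Real.sqrt (2 * Real.pi))) * Real.exp (-x ^ 2 / (2 * σ ^ 2))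

/-- The value function determined by the Q-function `Q₀` shifted by `d`. -/
noncomputable def V (Q₀ : ℝ → ℝ) (σ d : ℝ) : ℝ := ∫ x, gauss σ x * Q₀ (x - d)

theorem integrable_continuous_mul_of_support_Icc {w : ℝ} {Q f : ℝ → ℝ} (hQmeas : Measurable Q)
    (hQbdd : ∃ C : ℝ, ∀ x, Q x ≤ C) (hQnonneg : ∀ x, 0 ≤ Q x)
    (hQsupp : ∀ x, x ∉ Set.Icc 0 w → Q x = 0) (hf : Continuous f) :
    Integrable (fun x => f x * Q x) := by
  obtain ⟨C, hC⟩ := hQbdd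
  have hQ : IntegrableOn Q (Set.Icc 0 w) :=
    Measure.integrableOn_of_bounded (M := C) (by simp) hQmeas.aestronglyMeasurable
      (Filter.Eventually.of_forall fun x => by
        rw [Real.norm_eq_abs, abs_of_nonneg (hQnonneg x)]; exact hC x)
  refine (integrableOn_iff_integrable_of_support_subset ?_).1
    (hQ.continuousOn_mul hf.continuousOn isCompact_Icc)
  intro x hx
  by_contra h
  exact hx (by simp [hQsupp x h])

theorem integral_mul_lt_integral_mul_of_support_Icc {w : ℝ} {Q f g : ℝ → ℝ}
    (hQmeas : Measurable Q)
    (hQbdd : ∃ C : ℝ, ∀ x, Q x ≤ C) (hQnonneg : ∀ x, 0 ≤ Q x)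
    (hQsupp : ∀ x, x ∉ Set.Icc 0 w → Q x = 0) (hQne : ¬ (Q =ᵐ[volume] 0))
    (hf : Continuous f) (hg : Continuous g) (hfg : ∀ x ∈ Set.Icc 0 w, f x < g x) :
    ∫ x, f x * Q x < ∫ x, g x * Q x := by
  have hif := integrable_continuous_mul_of_support_Icc hQmeas hQbdd hQnonneg hQsupp hf
  have hig := integrable_continuous_mul_of_support_Icc hQmeas hQbdd hQnonneg hQsupp hg
  have hle : ∀ x, f x * Q x ≤ g x * Q x := fun x => by
    by_cases hx : x ∈ Set.Icc 0 w
    · exact mul_le_mul_of_nonneg_right (hfg x hx).le (hQnonneg x)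
    · simp [hQsupp x hx]
  refine lt_of_le_of_ne (integral_mono hif hig hle) fun heq => hQne ?_
  filter_upwards [(integral_eq_iff_of_ae_le hif hig (Filter.Eventually.of_forall hle)).1 heq]
    with x hx
  by_cases hxw : x ∈ Set.Icc 0 w
  · by_contra hne
    exact (hfg x hxw).ne (mul_right_cancel₀ hne hx)
  · exact hQsupp x hxw

theorem V_eq_integral_shift (Q : ℝ → ℝ) (σ d : ℝ) :
    V Q σ d = ∫ y, gauss σ (y + d) * Q y := by
  rw [V, ← integral_add_right_eq_self _ d]
  simp

theorem continuous_gauss (σ : ℝ) : Continuous (gauss σ) := by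
  unfold gauss
  fun_prop

theorem gauss_eq_inv_mul_exp (σ x : ℝ) :
    gauss σ x = (√(2 * π))⁻¹ * (σ⁻¹ * rexp (-(σ⁻¹ * x) ^ 2 / 2)) := by
  have h : -x ^ 2 / (2 * σ ^ 2) = -(σ⁻¹ * x) ^ 2 / 2 := by
    rw [mul_pow, inv_pow, div_eq_mul_inv, mul_inv]
    ring
  rw [gauss, h, one_div, mul_inv]
  ring

/-- The derivative of the standard Gaussian density under rescaling, up to normalization. -/
noncomputable def scaleDeriv (s : ℝ) : ℝ := (1 - s ^ 2) * rexp (-s ^ 2 / 2)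

theorem continuous_scaleDeriv : Continuous scaleDeriv := by
  unfold scaleDeriv
  fun_prop

theorem abs_scaleDeriv_le (s : ℝ) : |scaleDeriv s| ≤ 2 := by
  have h := Real.add_one_le_exp (s ^ 2 / 2)
  have hmul : rexp (s ^ 2 / 2) * rexp (-s ^ 2 / 2) = 1 := by
    rw [← Real.exp_add]
    simp [neg_div]
  rw [scaleDeriv, abs_mul, abs_of_pos (Real.exp_pos (-s ^ 2 / 2))]
  have h1 : |1 - s ^ 2| ≤ 2 * rexp (s ^ 2 / 2) :=
    abs_le.2 ⟨by nlinarith, by nlinarith [sq_nonneg s]⟩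
  nlinarith [mul_le_mul_of_nonneg_right h1 (Real.exp_pos (-s ^ 2 / 2)).le]

theorem hasDerivAt_scaleDeriv (s : ℝ) :
    HasDerivAt scaleDeriv (s * (s ^ 2 - 3) * rexp (-s ^ 2 / 2)) s := by
  have hp : HasDerivAt (fun s : ℝ => s ^ 2) (2 * s) s := by simpa using hasDerivAt_pow 2 s
  refine ((hp.const_sub 1).mul ((hp.neg.div_const 2).exp)).congr_deriv ?_
  simp only [Pi.neg_apply]
  ring

theorem strictAntiOn_scaleDeriv : StrictAntiOn scaleDeriv (Set.Icc 0 (√3)) := by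
  refine strictAntiOn_of_deriv_neg (convex_Icc _ _) continuous_scaleDeriv.continuousOn ?_
  intro s hs
  rw [interior_Icc] at hs
  rw [(hasDerivAt_scaleDeriv s).deriv]
  have h3 : s ^ 2 < 3 := (Real.lt_sqrt hs.1.le).1 hs.2
  exact mul_neg_of_neg_of_pos (mul_neg_of_pos_of_neg hs.1 (by linarith)) (Real.exp_pos _)

theorem hasDerivAt_mul_exp_scale (x a : ℝ) :
    HasDerivAt (fun a => a * rexp (-(a * x) ^ 2 / 2)) (scaleDeriv (a * x)) a := by
  have hp : HasDerivAt (fun a : ℝ => (a * x) ^ 2) (2 * (a * x) * x) a := by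
    refine (((hasDerivAt_id a).mul_const x).pow 2).congr_deriv ?_
    simp
  refine ((hasDerivAt_id a).mul ((hp.neg.div_const 2).exp)).congr_deriv ?_
  simp only [Pi.neg_apply, id, scaleDeriv]
  ring

theorem integral_scaleDeriv_eq_zero_of_maximizer {w : ℝ} {Q : ℝ → ℝ} (hQmeas : Measurable Q)
    (hQbdd : ∃ C : ℝ, ∀ x, Q x ≤ C) (hQnonneg : ∀ x, 0 ≤ Q x)
    (hQsupp : ∀ x, x ∉ Set.Icc 0 w → Q x = 0) {d σ : ℝ} (hσ : 0 < σ)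
    (hmax : ∀ τ : ℝ, 0 < τ → V Q τ d ≤ V Q σ d) :
    ∫ y, scaleDeriv (σ⁻¹ * (y + d)) * Q y = 0 := by
  have hintegrable {f : ℝ → ℝ} (hf : Continuous f) : Integrable (fun x => f x * Q x) :=
    integrable_continuous_mul_of_support_Icc hQmeas hQbdd hQnonneg hQsupp hf
  have hderiv : HasDerivAt (fun a => ∫ y, a * rexp (-(a * (y + d)) ^ 2 / 2) * Q y)
      (∫ y, scaleDeriv (σ⁻¹ * (y + d)) * Q y) σ⁻¹ := by
    have hscale : Continuous fun y => scaleDeriv (σ⁻¹ * (y + d)) :=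
      continuous_scaleDeriv.comp (by fun_prop)
    refine (hasDerivAt_integral_of_dominated_loc_of_deriv_le (s := Set.univ)
      (bound := fun y => 2 * Q y) (F' := fun a y => scaleDeriv (a * (y + d)) * Q y)
      Filter.univ_mem (Filter.Eventually.of_forall fun a => ?_) ?_ ?_ ?_ ?_ ?_).2
    · exact (hintegrable (f := fun y => a * rexp (-(a * (y + d)) ^ 2 / 2))
        (by fun_prop)).aestronglyMeasurable
    · exact hintegrable (f := fun y => σ⁻¹ * rexp (-(σ⁻¹ * (y + d)) ^ 2 / 2)) (by fun_prop)
    · exact (hintegrable hscale).aestronglyMeasurable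
    · refine Filter.Eventually.of_forall fun y a _ => ?_
      rw [Real.norm_eq_abs, abs_mul, abs_of_nonneg (hQnonneg y)]
      exact mul_le_mul_of_nonneg_right (abs_scaleDeriv_le _) (hQnonneg y)
    · exact hintegrable (f := fun _ => 2) continuous_const
    · exact Filter.Eventually.of_forall fun y a _ =>
        (hasDerivAt_mul_exp_scale (y + d) a).mul_const (Q y)
  have hV (τ : ℝ) : V Q τ d =
      (√(2 * π))⁻¹ * ∫ y, τ⁻¹ * rexp (-(τ⁻¹ * (y + d)) ^ 2 / 2) * Q y := by
    rw [V_eq_integral_shift, ← integral_const_mul]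
    simp only [gauss_eq_inv_mul_exp, mul_assoc]
  refine IsLocalMax.hasDerivAt_eq_zero ?_ hderiv
  filter_upwards [lt_mem_nhds (inv_pos.2 hσ)] with a ha
  have h := hmax a⁻¹ (inv_pos.2 ha)
  rw [hV, hV, inv_inv] at h
  exact le_of_mul_le_mul_left h (by positivity)

theorem le_of_maximizer {w : ℝ} {Q : ℝ → ℝ} (hQmeas : Measurable Q)
    (hQbdd : ∃ C : ℝ, ∀ x, Q x ≤ C) (hQnonneg : ∀ x, 0 ≤ Q x)
    (hQsupp : ∀ x, x ∉ Set.Icc 0 w → Q x = 0) (hQne : ¬ (Q =ᵐ[volume] 0)) {d σ : ℝ}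
    (hσ : 0 < σ) (hmax : ∀ τ : ℝ, 0 < τ → V Q τ d ≤ V Q σ d) : d ≤ σ := by
  by_contra! hlt
  have h := integral_mul_lt_integral_mul_of_support_Icc (g := fun _ => 0) hQmeas hQbdd hQnonneg
    hQsupp hQne (continuous_scaleDeriv.comp (f := fun y => σ⁻¹ * (y + d)) (by fun_prop))
    continuous_const fun y hy => ?_
  · have h0 := integral_scaleDeriv_eq_zero_of_maximizer hQmeas hQbdd hQnonneg hQsupp hσ hmax
    simp only [Function.comp_apply, h0, zero_mul, integral_zero, lt_irrefl] at h
  · have hs : 1 < σ⁻¹ * (y + d) := by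
      rw [inv_mul_eq_div, one_lt_div hσ]
      linarith [hy.1]
    exact mul_neg_of_neg_of_pos (by nlinarith) (Real.exp_pos _)

theorem gauss_lt_gauss {σ x y : ℝ} (hσ : 0 < σ) (hx : 0 ≤ x) (hxy : x < y) :
    gauss σ y < gauss σ x := by
  unfold gauss
  gcongr

theorem optimal_sigma_increases_when_value_decreases (w : ℝ) (hw : 0 < w) (Q₀ : ℝ → ℝ)
    (hQmeas : Measurable Q₀) (hQbdd : ∃ C : ℝ, ∀ x, Q₀ x ≤ C)
    (hQnonneg : ∀ x, 0 ≤ Q₀ x)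
    (hQsupp : ∀ x, x ∉ Set.Icc 0 w → Q₀ x = 0)
    (hQne : ¬ (Q₀ =ᵐ[volume] 0))
    (d₁ d₂ : ℝ) (hd₁ : 0 < d₁) (hd : d₁ < d₂)
    (hratio : w / d₁ < Real.sqrt 3 - 1)
    (σ₁ σ₂ : ℝ) (hσ₁ : 0 < σ₁) (hσ₂ : 0 < σ₂)
    (hmax₁ : ∀ σ : ℝ, 0 < σ → V Q₀ σ d₁ ≤ V Q₀ σ₁ d₁)
    (hmax₂ : ∀ σ : ℝ, 0 < σ → V Q₀ σ d₂ ≤ V Q₀ σ₂ d₂) :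
    σ₁ < σ₂ ∧ V Q₀ σ₂ d₂ < V Q₀ σ₁ d₁ := by
  have hd₂ : 0 < d₂ := hd₁.trans hd
  constructor
  · by_contra! hle
    have h1 := integral_scaleDeriv_eq_zero_of_maximizer hQmeas hQbdd hQnonneg hQsupp hσ₁ hmax₁
    have h2 := integral_scaleDeriv_eq_zero_of_maximizer hQmeas hQbdd hQnonneg hQsupp hσ₂ hmax₂
    have hd₂σ₂ := le_of_maximizer hQmeas hQbdd hQnonneg hQsupp hQne hσ₂ hmax₂
    have h := integral_mul_lt_integral_mul_of_support_Icc hQmeas hQbdd hQnonneg hQsupp hQne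
      (continuous_scaleDeriv.comp (f := fun y => σ₂⁻¹ * (y + d₂)) (by fun_prop))
      (continuous_scaleDeriv.comp (f := fun y => σ₁⁻¹ * (y + d₁)) (by fun_prop)) fun y hy => ?_
    · simp only [Function.comp_apply, h1, h2, lt_irrefl] at h
    · have hs1 : 0 ≤ σ₁⁻¹ * (y + d₁) := mul_nonneg (by positivity) (by linarith [hy.1])
      have hs12 : σ₁⁻¹ * (y + d₁) < σ₂⁻¹ * (y + d₂) :=
        mul_lt_mul' (inv_anti₀ hσ₂ hle) (by linarith) (by linarith [hy.1]) (by positivity)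
      have hs2 : σ₂⁻¹ * (y + d₂) ≤ √3 := by
        rw [inv_mul_eq_div, div_le_iff₀ hσ₂]
        rw [div_lt_iff₀ hd₁] at hratio
        have h3 : 1 ≤ √3 := Real.one_le_sqrt.2 (by norm_num)
        nlinarith [hy.2, mul_le_mul_of_nonneg_left hd₂σ₂ (Real.sqrt_nonneg 3)]
      exact strictAntiOn_scaleDeriv ⟨hs1, hs12.le.trans hs2⟩ ⟨hs1.trans hs12.le, hs2⟩ hs12
  · refine lt_of_lt_of_le ?_ (hmax₁ σ₂ hσ₂)
    rw [V_eq_integral_shift, V_eq_integral_shift]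
    exact integral_mul_lt_integral_mul_of_support_Icc hQmeas hQbdd hQnonneg hQsupp hQne
      ((continuous_gauss σ₂).comp (by fun_prop)) ((continuous_gauss σ₂).comp (by fun_prop))
      fun y hy => gauss_lt_gauss hσ₂ (by linarith [hy.1]) (by linarith)
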